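/- Let k ≥ 0, ℓ ≥ 1, λ ∈ P_ℓ^k, z an integer with 1 ≤ z ≤ bot_λ − 1, and a ≥ 1 an integer such that d := down_λ^a(z) ∈ [1, bot_λ] (so down_λ^{a+1}(z) is defined). Suppose γ := λ − ε_d ∈ P_ℓ^k. Then K(Δ^k(λ); M_z(λ); λ − ε_d) = ĝ_γ^{(z)} − T + K(Δ^k(λ); M_z(λ); λ − ε_{down_λ^{a+1}(z)}), where T := K(Δ^k(γ); M_z(γ); γ − ε_{down_γ^{a+1}(z)}) if the iterate down_γ^{a+1}(z) (computed in the root ideal Δ^k(γ)) is defined, and T := 0 otherwise. -/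

import Mathlib

open scoped Classical

noncomputable section

/-- The ambient ring: formal power series over ℚ in countably many variables. -/
abbrev R : Type := MvPowerSeries ℕ ℚ

/-- The complete homogeneous symmetric function `h_m` (equal to `0` for `m < 0`):
its coefficient at a monomial is `1` if the monomial has total degree `m`, else `0`. -/
def hh (m : ℤ) : R := fun d => if ((d.sum fun _ e => (e : ℤ)) = m) then 1 else 0

/-- The inhomogeneous analogue `k_m^{(r)} = ∑_{i=0}^{m} C(r+i−1, i) · h_{m−i}`. -/
def kk (r : ℕ) (m : ℤ) : R :=
  ∑ i ∈ Finset.range (m.toNat + 1), ((r + i - 1).choose i : ℚ) • hh (m - (i : ℤ))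

/-- The dual stable Grothendieck polynomial `g_γ`, as an `ℓ × ℓ` determinant with
`(i,j)` entry `k_{γ_i + j − i}^{(i−1)}` (indices 1-based). -/
def gg (ℓ : ℕ) (γ : ℕ → ℤ) : R :=
  (Matrix.of fun i j : Fin ℓ =>
    kk i.val (γ (i.val + 1) + (j.val : ℤ) - (i.val : ℤ))).det

/-- The `i`-th standard basis vector `ε_i`. -/
def eps (i : ℕ) : ℕ → ℤ := fun x => if x = i then 1 else 0

/-- The Katalan function `K(Ψ; M; γ)`. -/
def katalan (ℓ : ℕ) (Ψ : Finset (ℕ × ℕ)) (M : Multiset ℕ) (γ : ℕ → ℤ) : R :=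
  (M.powerset.map fun S =>
    (-1 : R) ^ Multiset.card S *
      ∑ᶠ α : {p // p ∈ Ψ} → ℕ,
        gg ℓ (fun x =>
          γ x + (∑ p ∈ Ψ.attach, (α p : ℤ) * (eps p.1.1 x - eps p.1.2 x))
            - (S.map fun z => eps z x).sum)).sum

/-- The set of positive roots `Δ_ℓ^+ = {(i,j) : 1 ≤ i < j ≤ ℓ}`. -/
def DeltaPlus (ℓ : ℕ) : Finset (ℕ × ℕ) :=
  (Finset.Icc 1 ℓ ×ˢ Finset.Icc 1 ℓ).filter fun p => p.1 < p.2

/-- A root ideal: an upper order ideal of `Δ_ℓ^+`. -/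
def IsRootIdeal (ℓ : ℕ) (Ψ : Finset (ℕ × ℕ)) : Prop :=
  Ψ ⊆ DeltaPlus ℓ ∧
    ∀ a b c d : ℕ, (a, b) ∈ Ψ → (c, d) ∈ DeltaPlus ℓ → c ≤ a → b ≤ d → (c, d) ∈ Ψ

/-- The root ideal `Δ^k(λ) = {(i,j) ∈ Δ_ℓ^+ : j > k − λ_i + i}`. -/
def DeltaK (k ℓ : ℕ) (lam : ℕ → ℤ) : Finset (ℕ × ℕ) :=
  (DeltaPlus ℓ).filter fun p => (k : ℤ) - lam p.1 + (p.1 : ℤ) < (p.2 : ℤ)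

/-- `bot(Ψ)`: the largest `x` such that row `x` of `Ψ` is nonempty (`0` if `Ψ = ∅`). -/
def botIdeal (Ψ : Finset (ℕ × ℕ)) : ℕ := Ψ.sup Prod.fst

/-- `bot_λ := bot(Δ^k(λ))`. -/
def botL (k ℓ : ℕ) (lam : ℕ → ℤ) : ℕ := botIdeal (DeltaK k ℓ lam)

/-- A removable root of a root ideal. -/
def IsRemovable (ℓ : ℕ) (Ψ : Finset (ℕ × ℕ)) (α : ℕ × ℕ) : Prop :=
  α ∈ Ψ ∧ IsRootIdeal ℓ (Ψ.erase α)

/-- `down_Ψ(x)` is defined, i.e. row `x` of `Ψ` contains a removable root. -/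
def HasDown (ℓ : ℕ) (Ψ : Finset (ℕ × ℕ)) (x : ℕ) : Prop :=
  ∃ j, IsRemovable ℓ Ψ (x, j)

/-- `down_Ψ(x)`: the column of the removable root in row `x` (junk value `0` if
row `x` has no removable root). -/
def down (ℓ : ℕ) (Ψ : Finset (ℕ × ℕ)) (x : ℕ) : ℕ :=
  ((Ψ.filter fun p => p.1 = x ∧ IsRemovable ℓ Ψ p).image Prod.snd).sup id

/-- `down_λ := down_{Δ^k(λ)}`. -/
def downL (k ℓ : ℕ) (lam : ℕ → ℤ) : ℕ → ℕ := down ℓ (DeltaK k ℓ lam)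

/-- The `a`-fold iterate `down_Ψ^a(x)` is defined. -/
def DownIterDefined (ℓ : ℕ) (Ψ : Finset (ℕ × ℕ)) (a x : ℕ) : Prop :=
  ∀ b < a, HasDown ℓ Ψ ((down ℓ Ψ)^[b] x)

/-- `L(ℛ)`: the multiset of second components of `ℛ`, with multiplicity. -/
def Lmul (ℛ : Finset (ℕ × ℕ)) : Multiset ℕ := ℛ.val.map Prod.snd

/-- `λ ∈ P_ℓ^k`: a `k`-bounded partition with `ℓ` parts allowed to be zero. -/
def IsKBounded (k ℓ : ℕ) (lam : ℕ → ℤ) : Prop :=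
  lam 1 ≤ (k : ℤ) ∧ (∀ i, 1 ≤ i → i < ℓ → lam (i + 1) ≤ lam i) ∧ 0 ≤ lam ℓ

/-- The multiset `M_z(λ)`: `L(Δ^k(λ))` with one occurrence of `down_λ(x)` removed
for each `x ∈ [z, bot_λ]`. -/
def Mz (k ℓ : ℕ) (lam : ℕ → ℤ) (z : ℕ) : Multiset ℕ :=
  Lmul (DeltaK k ℓ lam) - ((Finset.Icc z (botL k ℓ lam)).val.map (downL k ℓ lam))

/-- The `K`-`k`-Schur function of weight `z`: `ĝ_λ^{(z)} = K(Δ^k(λ); M_z(λ); λ)`. -/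
def wkschur (k ℓ : ℕ) (lam : ℕ → ℤ) (z : ℕ) : R :=
  katalan ℓ (DeltaK k ℓ lam) (Mz k ℓ lam z) lam

/-- The `K`-`k`-Schur function `g_λ^{(k)} = K(Δ^k(λ); L(Δ^{k+1}(λ)); λ)`. -/
def kkschur (k ℓ : ℕ) (lam : ℕ → ℤ) : R :=
  katalan ℓ (DeltaK k ℓ lam) (Lmul (DeltaK (k + 1) ℓ lam)) lam

/-- The closed `k`-Schur Katalan function `𝔤_λ^{(k)} = K(Δ^k(λ); L(Δ^k(λ)); λ)`. -/
def closedkschur (k ℓ : ℕ) (lam : ℕ → ℤ) : R :=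
  katalan ℓ (DeltaK k ℓ lam) (Lmul (DeltaK k ℓ lam)) lam

/-- `|λ| = λ_1 + ⋯ + λ_ℓ`. -/
def psize (ℓ : ℕ) (lam : ℕ → ℤ) : ℤ := ∑ i ∈ Finset.Icc 1 ℓ, lam i

/-! ### Finiteness of the Katalan expansion -/

lemma hh_of_neg {m : ℤ} (hm : m < 0) : hh m = 0 := by
  funext d
  have h : (0 : ℤ) ≤ d.sum fun _ e => (e : ℤ) :=
    Finset.sum_nonneg fun _ _ => Int.natCast_nonneg _
  exact if_neg (by omega)

lemma kk_of_neg (r : ℕ) {m : ℤ} (hm : m < 0) : kk r m = 0 :=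
  Finset.sum_eq_zero fun i _ => by rw [hh_of_neg (by omega), smul_zero]

lemma gg_eq_zero {ℓ : ℕ} {γ : ℕ → ℤ} {x : ℕ} (h1 : 1 ≤ x) (hx : x ≤ ℓ)
    (h : γ x + ℓ < x) : gg ℓ γ = 0 := by
  refine Matrix.det_eq_zero_of_row_eq_zero ⟨x - 1, by omega⟩ fun j => ?_
  have hj := j.isLt
  have hx' : x - 1 + 1 = x := by omega
  simp only [Matrix.of_apply, hx']
  exact kk_of_neg _ (by omega)

/-- The weight `γ + ∑ α(i,j) (ε_i - ε_j)`. -/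
def shiftedWeight (Ψ : Finset (ℕ × ℕ)) (γ : ℕ → ℤ) (α : {p // p ∈ Ψ} → ℕ) : ℕ → ℤ :=
  fun x => γ x + ∑ p ∈ Ψ.attach, (α p : ℤ) * (eps p.1.1 x - eps p.1.2 x)

/-- The expansion of `∏_{(i,j) ∈ Ψ} (1 - R_{ij})⁻¹ g_γ`. -/
def raisingSum (ℓ : ℕ) (Ψ : Finset (ℕ × ℕ)) (γ : ℕ → ℤ) : R :=
  ∑ᶠ α : {p // p ∈ Ψ} → ℕ, gg ℓ (shiftedWeight Ψ γ α)

lemma mem_DeltaPlus_iff {ℓ : ℕ} {p : ℕ × ℕ} :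
    p ∈ DeltaPlus ℓ ↔ 1 ≤ p.1 ∧ p.1 < p.2 ∧ p.2 ≤ ℓ := by
  simp only [DeltaPlus, Finset.mem_filter, Finset.mem_product, Finset.mem_Icc]
  omega

lemma mem_DeltaPlus {ℓ i j : ℕ} : (i, j) ∈ DeltaPlus ℓ ↔ 1 ≤ i ∧ i < j ∧ j ≤ ℓ :=
  mem_DeltaPlus_iff

lemma sum_mul_eps {ℓ i : ℕ} (h1 : 1 ≤ i) (h2 : i ≤ ℓ) :
    ∑ x ∈ Finset.Icc 1 ℓ, (x : ℤ) * eps i x = i := by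
  simp [eps, h1, h2]

lemma sum_mul_shiftedWeight {ℓ : ℕ} {Ψ : Finset (ℕ × ℕ)} (hΨ : Ψ ⊆ DeltaPlus ℓ)
    (γ : ℕ → ℤ) (α : {p // p ∈ Ψ} → ℕ) :
    ∑ x ∈ Finset.Icc 1 ℓ, (x : ℤ) * shiftedWeight Ψ γ α x =
      ∑ x ∈ Finset.Icc 1 ℓ, (x : ℤ) * γ x +
        ∑ p ∈ Ψ.attach, (α p : ℤ) * ((p.1.1 : ℤ) - p.1.2) := by
  simp only [shiftedWeight, mul_add, Finset.sum_add_distrib, Finset.mul_sum]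
  rw [Finset.sum_comm]
  congr 1
  refine Finset.sum_congr rfl fun p _ => ?_
  obtain ⟨h1, h2, h3⟩ := mem_DeltaPlus_iff.1 (hΨ p.2)
  rw [← sum_mul_eps (ℓ := ℓ) (i := p.1.1) h1 (by omega),
    ← sum_mul_eps (ℓ := ℓ) (i := p.1.2) (by omega) h3, ← Finset.sum_sub_distrib,
    Finset.mul_sum]
  exact Finset.sum_congr rfl fun x _ => by ring

lemma finite_support_gg_shiftedWeight {ℓ : ℕ} {Ψ : Finset (ℕ × ℕ)} (hΨ : Ψ ⊆ DeltaPlus ℓ)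
    (γ : ℕ → ℤ) : (Function.support fun α => gg ℓ (shiftedWeight Ψ γ α)).Finite := by
  set B : ℤ := ∑ x ∈ Finset.Icc 1 ℓ, (x : ℤ) * γ x -
    ∑ x ∈ Finset.Icc 1 ℓ, (x : ℤ) * ((x : ℤ) - ℓ) with hB
  refine (Set.finite_Iic (fun _ : {p // p ∈ Ψ} => B.toNat)).subset fun α hα q => ?_
  have hlow : ∑ x ∈ Finset.Icc 1 ℓ, (x : ℤ) * ((x : ℤ) - ℓ) ≤
      ∑ x ∈ Finset.Icc 1 ℓ, (x : ℤ) * shiftedWeight Ψ γ α x := by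
    refine Finset.sum_le_sum fun x hx => mul_le_mul_of_nonneg_left ?_ (by positivity)
    rw [Finset.mem_Icc] at hx
    by_contra hlt
    exact hα (gg_eq_zero hx.1 hx.2 (by omega))
  rw [sum_mul_shiftedWeight hΨ] at hlow
  have hq : (α q : ℤ) ≤ ∑ p ∈ Ψ.attach, (α p : ℤ) * ((p.1.2 : ℤ) - p.1.1) := by
    have hpos : ∀ p : {p // p ∈ Ψ}, (1 : ℤ) ≤ (p.1.2 : ℤ) - p.1.1 := fun p => by
      obtain ⟨_, h2, _⟩ := mem_DeltaPlus_iff.1 (hΨ p.2)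
      omega
    calc (α q : ℤ) ≤ (α q : ℤ) * ((q.1.2 : ℤ) - q.1.1) :=
          le_mul_of_one_le_right (by positivity) (hpos q)
      _ ≤ _ := Finset.single_le_sum
          (f := fun p : {p // p ∈ Ψ} => (α p : ℤ) * ((p.1.2 : ℤ) - p.1.1))
          (fun p _ => mul_nonneg (by positivity) (by linarith [hpos p]))
          (Finset.mem_attach _ q)
  have hneg : ∑ p ∈ Ψ.attach, (α p : ℤ) * ((p.1.2 : ℤ) - p.1.1) =
      -∑ p ∈ Ψ.attach, (α p : ℤ) * ((p.1.1 : ℤ) - p.1.2) := by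
    rw [← Finset.sum_neg_distrib]
    exact Finset.sum_congr rfl fun p _ => by ring
  have : (α q : ℤ) ≤ B := by rw [hB]; linarith
  change α q ≤ B.toNat
  omega

/-! ### Recurrences for Katalan functions -/

/-- Extension by zero of an exponent vector on `Ψ.erase β` to `Ψ`. -/
def extendExponent {Ψ : Finset (ℕ × ℕ)} (β : ℕ × ℕ) (α : {p // p ∈ Ψ.erase β} → ℕ) :
    {p // p ∈ Ψ} → ℕ :=
  fun p => if h : p.1 = β then 0 else α ⟨p.1, Finset.mem_erase.2 ⟨h, p.2⟩⟩

lemma extendExponent_injective {Ψ : Finset (ℕ × ℕ)} (β : ℕ × ℕ) :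
    Function.Injective (extendExponent (Ψ := Ψ) β) := by
  intro α α' h
  funext p
  have hp := Finset.mem_erase.1 p.2
  simpa [extendExponent, hp.1] using congrFun h ⟨p.1, hp.2⟩

lemma range_extendExponent {Ψ : Finset (ℕ × ℕ)} {β : ℕ × ℕ} (hβ : β ∈ Ψ) :
    Set.range (extendExponent (Ψ := Ψ) β) = {α | α ⟨β, hβ⟩ = 0} := by
  ext α
  constructor
  · rintro ⟨α, rfl⟩
    simp [extendExponent]
  · intro h
    refine ⟨fun p => α ⟨p.1, Finset.mem_of_mem_erase p.2⟩, ?_⟩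
    funext p
    by_cases hp : p.1 = β
    · obtain ⟨p, hpΨ⟩ := p
      subst hp
      simpa [extendExponent] using h.symm
    · simp [extendExponent, hp]

lemma range_add_single {Ψ : Finset (ℕ × ℕ)} {β : ℕ × ℕ} (hβ : β ∈ Ψ) :
    Set.range (fun α : {p // p ∈ Ψ} → ℕ => α + Pi.single ⟨β, hβ⟩ 1) =
      {α | α ⟨β, hβ⟩ = 0}ᶜ := by
  ext α
  constructor
  · rintro ⟨α, rfl⟩
    simp
  · intro h
    refine ⟨α - Pi.single ⟨β, hβ⟩ 1, ?_⟩
    funext p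
    by_cases hp : p = ⟨β, hβ⟩
    · subst hp
      have : α ⟨β, hβ⟩ ≠ 0 := h
      simp only [Pi.add_apply, Pi.sub_apply, Pi.single_eq_same]
      omega
    · simp [hp]

lemma shiftedWeight_extendExponent {Ψ : Finset (ℕ × ℕ)} (β : ℕ × ℕ) (γ : ℕ → ℤ)
    (α : {p // p ∈ Ψ.erase β} → ℕ) :
    shiftedWeight Ψ γ (extendExponent β α) = shiftedWeight (Ψ.erase β) γ α := by
  funext x
  let f : ℕ × ℕ → ℤ := fun p =>
    (if h : p ∈ Ψ.erase β then (α ⟨p, h⟩ : ℤ) else 0) * (eps p.1 x - eps p.2 x)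
  have h1 : ∑ p ∈ Ψ.attach, (extendExponent β α p : ℤ) * (eps p.1.1 x - eps p.1.2 x) =
      ∑ p ∈ Ψ, f p := by
    rw [← Finset.sum_attach Ψ f]
    refine Finset.sum_congr rfl fun p _ => ?_
    by_cases hp : p.1 = β <;> simp [f, extendExponent, hp]
  have h2 : ∑ p ∈ (Ψ.erase β).attach, (α p : ℤ) * (eps p.1.1 x - eps p.1.2 x) =
      ∑ p ∈ Ψ.erase β, f p := by
    rw [← Finset.sum_attach (Ψ.erase β) f]
    refine Finset.sum_congr rfl fun p _ => ?_
    have := p.2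
    simp only [f, this, dif_pos]
  have h3 : f β = 0 := by simp [f]
  simp only [shiftedWeight]
  rw [h1, h2, Finset.sum_erase _ h3]

lemma shiftedWeight_add_single {Ψ : Finset (ℕ × ℕ)} {β : ℕ × ℕ} (hβ : β ∈ Ψ) (γ : ℕ → ℤ)
    (α : {p // p ∈ Ψ} → ℕ) :
    shiftedWeight Ψ γ (α + Pi.single ⟨β, hβ⟩ 1) =
      shiftedWeight Ψ (γ + eps β.1 - eps β.2) α := by
  funext x
  simp only [shiftedWeight, Pi.add_apply, Pi.sub_apply, Nat.cast_add, add_mul,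
    Finset.sum_add_distrib]
  have : ∑ p ∈ Ψ.attach, ((Pi.single (⟨β, hβ⟩ : {p // p ∈ Ψ}) 1 : {p // p ∈ Ψ} → ℕ) p : ℤ) *
      (eps p.1.1 x - eps p.1.2 x) = eps β.1 x - eps β.2 x := by
    rw [Finset.sum_eq_single ⟨β, hβ⟩]
    · simp
    · intro p _ hp
      simp [hp]
    · simp
  rw [this]
  ring

lemma raisingSum_erase {ℓ : ℕ} {Ψ : Finset (ℕ × ℕ)} (hΨ : Ψ ⊆ DeltaPlus ℓ) {β : ℕ × ℕ}
    (hβ : β ∈ Ψ) (γ : ℕ → ℤ) :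
    raisingSum ℓ Ψ γ =
      raisingSum ℓ (Ψ.erase β) γ + raisingSum ℓ Ψ (γ + eps β.1 - eps β.2) := by
  have hfin := finite_support_gg_shiftedWeight hΨ γ
  rw [raisingSum, ← finsum_mem_univ, ← Set.union_compl_self {α | α ⟨β, hβ⟩ = 0},
    finsum_mem_union' disjoint_compl_right (hfin.inter_of_right _) (hfin.inter_of_right _),
    ← range_add_single hβ, ← range_extendExponent hβ,
    finsum_mem_range (extendExponent_injective β),
    finsum_mem_range (add_left_injective _)]
  simp only [shiftedWeight_extendExponent, shiftedWeight_add_single hβ, raisingSum]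

lemma katalan_eq (ℓ : ℕ) (Ψ : Finset (ℕ × ℕ)) (M : Multiset ℕ) (γ : ℕ → ℤ) :
    katalan ℓ Ψ M γ = (M.powerset.map fun S =>
      (-1 : R) ^ Multiset.card S * raisingSum ℓ Ψ (γ - (S.map eps).sum)).sum := by
  have h : ∀ (S : Multiset ℕ) (x : ℕ), (S.map eps).sum x = (S.map fun z => eps z x).sum := by
    intro S x
    induction S using Multiset.induction_on with
    | empty => simp
    | cons a S ih => simp [ih]
  unfold katalan raisingSum
  congr 2
  funext S
  congr 2
  funext α
  congr 1
  funext x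
  simp only [shiftedWeight, Pi.sub_apply, h]
  ring

lemma katalan_erase {ℓ : ℕ} {Ψ : Finset (ℕ × ℕ)} (hΨ : Ψ ⊆ DeltaPlus ℓ) {β : ℕ × ℕ}
    (hβ : β ∈ Ψ) (M : Multiset ℕ) (γ : ℕ → ℤ) :
    katalan ℓ Ψ M γ =
      katalan ℓ (Ψ.erase β) M γ + katalan ℓ Ψ M (γ + eps β.1 - eps β.2) := by
  simp only [katalan_eq, ← Multiset.sum_map_add]
  congr 2
  funext S
  rw [raisingSum_erase hΨ hβ, mul_add]
  congr 3
  abel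

lemma katalan_cons (ℓ : ℕ) (Ψ : Finset (ℕ × ℕ)) (m : ℕ) (M : Multiset ℕ) (γ : ℕ → ℤ) :
    katalan ℓ Ψ (m ::ₘ M) γ = katalan ℓ Ψ M γ - katalan ℓ Ψ M (γ - eps m) := by
  simp only [katalan_eq, Multiset.powerset_cons, Multiset.map_add, Multiset.sum_add,
    Multiset.map_map, Function.comp_def, Multiset.card_cons, Multiset.map_cons,
    Multiset.sum_cons, ← sub_sub, pow_succ, mul_neg_one, neg_mul]
  rw [Multiset.sum_map_neg, ← sub_eq_add_neg]

/-! ### The root ideal of a bounded partition -/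

section Bounded

variable {k ℓ : ℕ} {lam : ℕ → ℤ}

lemma mem_DeltaK {i j : ℕ} : (i, j) ∈ DeltaK k ℓ lam ↔
    1 ≤ i ∧ i < j ∧ j ≤ ℓ ∧ (k : ℤ) - lam i + i < j := by
  rw [DeltaK, Finset.mem_filter, mem_DeltaPlus]
  tauto

lemma DeltaK_subset : DeltaK k ℓ lam ⊆ DeltaPlus ℓ := Finset.filter_subset _ _

lemma IsKBounded.antitone (h : IsKBounded k ℓ lam) {x y : ℕ} (hx : 1 ≤ x) (hxy : x ≤ y)
    (hy : y ≤ ℓ) : lam y ≤ lam x := by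
  induction y, hxy using Nat.le_induction with
  | base => rfl
  | succ y hxy ih => exact (h.2.1 y (by omega) (by omega)).trans (ih (by omega))

lemma IsKBounded.le (h : IsKBounded k ℓ lam) {x : ℕ} (hx : 1 ≤ x) (hxℓ : x ≤ ℓ) :
    lam x ≤ k := (h.antitone le_rfl hx hxℓ).trans h.1

lemma isRemovable_iff (h : IsKBounded k ℓ lam) {x j : ℕ} :
    IsRemovable ℓ (DeltaK k ℓ lam) (x, j) ↔
      1 ≤ x ∧ x ≤ ℓ ∧ j ≤ ℓ ∧ (j : ℤ) = k - lam x + x + 1 := by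
  constructor
  · rintro ⟨hmem, -, hup⟩
    obtain ⟨h1, h2, h3, h4⟩ := mem_DeltaK.1 hmem
    refine ⟨h1, by omega, h3, ?_⟩
    by_contra hne
    have hle := h.le h1 (by omega)
    have hpred : (x, j - 1) ∈ (DeltaK k ℓ lam).erase (x, j) := by
      rw [Finset.mem_erase, mem_DeltaK]
      refine ⟨fun heq => ?_, h1, by omega, by omega, by omega⟩
      have := (Prod.mk.inj heq).2
      omega
    exact Finset.notMem_erase _ _
      (hup x (j - 1) x j hpred (DeltaK_subset hmem) le_rfl (Nat.sub_le _ _))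
  · rintro ⟨h1, h2, h3, h4⟩
    have hle := h.le h1 h2
    refine ⟨mem_DeltaK.2 ⟨h1, by omega, h3, by omega⟩,
      (Finset.erase_subset _ _).trans DeltaK_subset, ?_⟩
    intro p q r s hpq hrs hrp hqs
    rw [Finset.mem_erase, mem_DeltaK] at hpq
    obtain ⟨hne, hp1, hp2, hp3, hp4⟩ := hpq
    obtain ⟨hr1, hr2, hr3⟩ := mem_DeltaPlus.1 hrs
    have hanti := h.antitone hr1 hrp (by omega)
    rw [Finset.mem_erase, mem_DeltaK]
    refine ⟨fun heq => hne ?_, hr1, hr2, hr3, by omega⟩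
    obtain ⟨rfl, rfl⟩ := Prod.mk.inj heq
    have hpr : p = r := by omega
    subst hpr
    rw [Prod.mk.injEq]
    omega

lemma down_eq_of_isRemovable (h : IsKBounded k ℓ lam) {x j : ℕ}
    (hj : IsRemovable ℓ (DeltaK k ℓ lam) (x, j)) : downL k ℓ lam x = j := by
  have : (DeltaK k ℓ lam).filter (fun p => p.1 = x ∧ IsRemovable ℓ (DeltaK k ℓ lam) p) =
      {(x, j)} := by
    ext ⟨p, q⟩
    simp only [Finset.mem_filter, Finset.mem_singleton, Prod.mk.injEq]
    constructor
    · rintro ⟨-, rfl, hq⟩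
      rw [isRemovable_iff h] at hq hj
      omega
    · rintro ⟨rfl, rfl⟩
      exact ⟨hj.1, rfl, hj⟩
  simp [downL, down, this]

lemma hasDown_iff (h : IsKBounded k ℓ lam) {x : ℕ} : HasDown ℓ (DeltaK k ℓ lam) x ↔
    1 ≤ x ∧ x ≤ ℓ ∧ (k : ℤ) - lam x + x + 1 ≤ ℓ := by
  simp only [HasDown, isRemovable_iff h]
  constructor
  · rintro ⟨j, h1, h2, h3, h4⟩
    exact ⟨h1, h2, by omega⟩
  · rintro ⟨h1, h2, h3⟩
    have := h.le h1 h2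
    exact ⟨((k : ℤ) - lam x + x + 1).toNat, h1, h2, by omega, by omega⟩

lemma coe_downL (h : IsKBounded k ℓ lam) {x : ℕ} (hx : HasDown ℓ (DeltaK k ℓ lam) x) :
    (downL k ℓ lam x : ℤ) = k - lam x + x + 1 := by
  obtain ⟨j, hj⟩ := hx
  rw [down_eq_of_isRemovable h hj]
  exact ((isRemovable_iff h).1 hj).2.2.2

lemma hasDown_of_downL_pos {x : ℕ} (hx : 1 ≤ downL k ℓ lam x) :
    HasDown ℓ (DeltaK k ℓ lam) x := by
  by_contra hno
  have : (DeltaK k ℓ lam).filter (fun p => p.1 = x ∧ IsRemovable ℓ (DeltaK k ℓ lam) p) = ∅ := by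
    refine Finset.filter_eq_empty_iff.2 ?_
    rintro ⟨p, q⟩ _ ⟨rfl, hr⟩
    exact hno ⟨q, hr⟩
  simp [downL, down, this] at hx

lemma lt_downL (h : IsKBounded k ℓ lam) {x : ℕ} (hx : HasDown ℓ (DeltaK k ℓ lam) x) :
    x < downL k ℓ lam x := by
  have h1 := coe_downL h hx
  have h2 := (hasDown_iff h).1 hx
  have h3 := h.le h2.1 h2.2.1
  omega

lemma downL_strictMono (h : IsKBounded k ℓ lam) {x y : ℕ} (hxy : x < y)
    (hx : HasDown ℓ (DeltaK k ℓ lam) x) (hy : HasDown ℓ (DeltaK k ℓ lam) y) :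
    downL k ℓ lam x < downL k ℓ lam y := by
  have h1 := coe_downL h hx
  have h2 := coe_downL h hy
  have h3 := (hasDown_iff h).1 hx
  have h4 := (hasDown_iff h).1 hy
  have h5 := h.antitone h3.1 hxy.le h4.2.1
  omega

lemma le_botL_iff (h : IsKBounded k ℓ lam) {x : ℕ} (hx : 1 ≤ x) :
    x ≤ botL k ℓ lam ↔ HasDown ℓ (DeltaK k ℓ lam) x := by
  constructor
  · intro hxb
    have hne : (DeltaK k ℓ lam).Nonempty := by
      by_contra hemp
      rw [Finset.not_nonempty_iff_eq_empty] at hemp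
      simp [botL, botIdeal, hemp] at hxb
      omega
    obtain ⟨⟨p, q⟩, hp, hsup⟩ := Finset.exists_mem_eq_sup _ hne Prod.fst
    have hxp : x ≤ p := hxb.trans hsup.le
    obtain ⟨hp1, hp2, hp3, hp4⟩ := mem_DeltaK.1 hp
    have := h.antitone hx hxp (by omega)
    exact (hasDown_iff h).2 ⟨hx, by omega, by omega⟩
  · rintro ⟨j, hj⟩
    exact Finset.le_sup (f := Prod.fst) hj.1

lemma iterate_downL (h : IsKBounded k ℓ lam) (z : ℕ) {a : ℕ}
    (ha : 1 ≤ (downL k ℓ lam)^[a] z) :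
    ∀ b < a, HasDown ℓ (DeltaK k ℓ lam) ((downL k ℓ lam)^[b] z) ∧
      (downL k ℓ lam)^[b] z < (downL k ℓ lam)^[a] z := by
  induction a with
  | zero => intro b hb; omega
  | succ a ih =>
    rw [Function.iterate_succ_apply'] at ha ⊢
    have hdown := hasDown_of_downL_pos ha
    have hlt := lt_downL h hdown
    have ih := ih ((hasDown_iff h).1 hdown).1
    intro b hb
    rcases Nat.lt_succ_iff_lt_or_eq.1 hb with hb | rfl
    · exact ⟨(ih b hb).1, (ih b hb).2.trans hlt⟩
    · exact ⟨hdown, hlt⟩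

/-! ### Lowering a part -/

variable {d : ℕ}

lemma hasDown_sub_eps_iff (h : IsKBounded k ℓ lam) (hγ : IsKBounded k ℓ (lam - eps d)) {x : ℕ}
    (hx : x ≠ d) :
    HasDown ℓ (DeltaK k ℓ (lam - eps d)) x ↔ HasDown ℓ (DeltaK k ℓ lam) x := by
  simp [hasDown_iff h, hasDown_iff hγ, eps, hx]

lemma downL_sub_eps (h : IsKBounded k ℓ lam) (hγ : IsKBounded k ℓ (lam - eps d)) {x : ℕ}
    (hx : x ≠ d) (hdown : HasDown ℓ (DeltaK k ℓ lam) x) :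
    downL k ℓ (lam - eps d) x = downL k ℓ lam x := by
  have h1 := coe_downL h hdown
  have h2 := coe_downL hγ ((hasDown_sub_eps_iff h hγ hx).2 hdown)
  simp only [Pi.sub_apply, eps, hx, if_false] at h2
  omega

lemma iterate_downL_sub_eps (h : IsKBounded k ℓ lam) (hγ : IsKBounded k ℓ (lam - eps d))
    {z a : ℕ} (hd : d = (downL k ℓ lam)^[a] z) (hd1 : 1 ≤ d) :
    ∀ b ≤ a, (downL k ℓ (lam - eps d))^[b] z = (downL k ℓ lam)^[b] z := by
  have key := iterate_downL h z (hd ▸ hd1)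
  intro b
  induction b with
  | zero => intro _; rfl
  | succ b ih =>
    intro hb
    obtain ⟨h1, h2⟩ := key b hb
    rw [Function.iterate_succ_apply', Function.iterate_succ_apply', ih (by omega),
      downL_sub_eps h hγ (by omega) h1]

lemma downIterDefined_sub_eps_iff (h : IsKBounded k ℓ lam)
    (hγ : IsKBounded k ℓ (lam - eps d)) {z a : ℕ} (hd : d = (downL k ℓ lam)^[a] z)
    (hd1 : 1 ≤ d) :
    DownIterDefined ℓ (DeltaK k ℓ (lam - eps d)) (a + 1) z ↔
      HasDown ℓ (DeltaK k ℓ (lam - eps d)) d := by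
  have key := iterate_downL h z (hd ▸ hd1)
  have hit := iterate_downL_sub_eps h hγ hd hd1
  constructor
  · intro hdef
    have := hdef a (Nat.lt_succ_self a)
    rw [hd] at hit ⊢
    rw [hd] at this
    rwa [show (down ℓ (DeltaK k ℓ (lam - eps ((downL k ℓ lam)^[a] z))))^[a] z = _ from
      hit a le_rfl] at this
  · intro hdown b hb
    rw [show (down ℓ (DeltaK k ℓ (lam - eps d)))^[b] z = _ from hit b (by omega)]
    rcases Nat.lt_succ_iff_lt_or_eq.1 hb with hb | rfl
    · obtain ⟨h1, h2⟩ := key b hb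
      exact (hasDown_sub_eps_iff h hγ (by omega)).2 h1
    · exact hd ▸ hdown

lemma DeltaK_sub_eps (h : IsKBounded k ℓ lam) (hdown : HasDown ℓ (DeltaK k ℓ lam) d) :
    DeltaK k ℓ (lam - eps d) = (DeltaK k ℓ lam).erase (d, downL k ℓ lam d) := by
  have hcoe := coe_downL h hdown
  ext ⟨i, j⟩
  rw [Finset.mem_erase, mem_DeltaK, mem_DeltaK, Ne, Prod.mk.injEq, Pi.sub_apply, eps]
  split_ifs with hi
  · subst hi
    omega
  · omega

lemma mem_Icc_botL (h : IsKBounded k ℓ lam) {z x : ℕ} (hz : 1 ≤ z) :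
    x ∈ Finset.Icc z (botL k ℓ lam) ↔ z ≤ x ∧ HasDown ℓ (DeltaK k ℓ lam) x := by
  rw [Finset.mem_Icc]
  exact and_congr_right fun hzx => le_botL_iff h (hz.trans hzx)

lemma map_downL_Icc_eq_cons (h : IsKBounded k ℓ lam) {z : ℕ} (hz : 1 ≤ z) (hzd : z ≤ d)
    (hdown : HasDown ℓ (DeltaK k ℓ lam) d) :
    (Finset.Icc z (botL k ℓ lam)).val.map (downL k ℓ lam) =
      downL k ℓ lam d ::ₘ ((Finset.Icc z (botL k ℓ lam)).erase d).val.map (downL k ℓ lam) := by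
  have hmem := (mem_Icc_botL h hz).2 ⟨hzd, hdown⟩
  rw [← Multiset.map_cons, Finset.erase_val, Multiset.cons_erase hmem]

lemma map_downL_erase_sub_eps (h : IsKBounded k ℓ lam) (hγ : IsKBounded k ℓ (lam - eps d))
    {z : ℕ} (hz : 1 ≤ z) :
    ((Finset.Icc z (botL k ℓ (lam - eps d))).erase d).val.map (downL k ℓ (lam - eps d)) =
      ((Finset.Icc z (botL k ℓ lam)).erase d).val.map (downL k ℓ lam) := by
  have hset : (Finset.Icc z (botL k ℓ (lam - eps d))).erase d =
      (Finset.Icc z (botL k ℓ lam)).erase d := by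
    ext x
    rw [Finset.mem_erase, Finset.mem_erase, mem_Icc_botL h hz, mem_Icc_botL hγ hz]
    exact and_congr_right fun hx => by rw [hasDown_sub_eps_iff h hγ hx]
  rw [hset]
  refine Multiset.map_congr rfl fun x hx => ?_
  obtain ⟨hxd, hx⟩ := Finset.mem_erase.1 (Finset.mem_def.2 hx)
  exact downL_sub_eps h hγ hxd ((mem_Icc_botL h hz).1 hx).2

lemma Mz_eq_sub (h : IsKBounded k ℓ lam) {z : ℕ} (hz : 1 ≤ z) (hzd : z ≤ d)
    (hdown : HasDown ℓ (DeltaK k ℓ lam) d) :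
    Mz k ℓ lam z = Lmul (DeltaK k ℓ (lam - eps d)) -
      ((Finset.Icc z (botL k ℓ lam)).erase d).val.map (downL k ℓ lam) := by
  have hmem : (d, downL k ℓ lam d) ∈ DeltaK k ℓ lam := by
    obtain ⟨j, hj⟩ := hdown
    rw [down_eq_of_isRemovable h hj]
    exact hj.1
  have hL : Lmul (DeltaK k ℓ lam) = downL k ℓ lam d ::ₘ Lmul (DeltaK k ℓ (lam - eps d)) := by
    rw [DeltaK_sub_eps h hdown, Lmul, Lmul, Finset.erase_val,
      ← Multiset.cons_erase (Finset.mem_def.1 hmem), Multiset.map_cons,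
      Multiset.erase_cons_head]
  rw [Mz, hL, map_downL_Icc_eq_cons h hz hzd hdown, Multiset.sub_cons,
    Multiset.erase_cons_head]

lemma Mz_sub_eps_of_not_hasDown (h : IsKBounded k ℓ lam) (hγ : IsKBounded k ℓ (lam - eps d))
    {z : ℕ} (hz : 1 ≤ z) (hzd : z ≤ d) (hdown : HasDown ℓ (DeltaK k ℓ lam) d)
    (hno : ¬ HasDown ℓ (DeltaK k ℓ (lam - eps d)) d) :
    Mz k ℓ (lam - eps d) z = Mz k ℓ lam z := by
  have hnot : d ∉ Finset.Icc z (botL k ℓ (lam - eps d)) := fun hmem =>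
    hno ((mem_Icc_botL hγ hz).1 hmem).2
  rw [Mz_eq_sub h hz hzd hdown, ← map_downL_erase_sub_eps h hγ hz,
    Finset.erase_eq_of_notMem hnot, Mz]

lemma Mz_eq_cons_of_hasDown (h : IsKBounded k ℓ lam) (hγ : IsKBounded k ℓ (lam - eps d))
    {z : ℕ} (hz : 1 ≤ z) (hzd : z ≤ d) (hdown : HasDown ℓ (DeltaK k ℓ lam) d)
    (hdownγ : HasDown ℓ (DeltaK k ℓ (lam - eps d)) d) :
    Mz k ℓ lam z = downL k ℓ (lam - eps d) d ::ₘ Mz k ℓ (lam - eps d) z := by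
  have hmem : (d, downL k ℓ (lam - eps d) d) ∈ DeltaK k ℓ (lam - eps d) := by
    obtain ⟨j, hj⟩ := hdownγ
    rw [down_eq_of_isRemovable hγ hj]
    exact hj.1
  rw [Mz_eq_sub h hz hzd hdown, Mz, map_downL_Icc_eq_cons hγ hz hzd hdownγ,
    ← map_downL_erase_sub_eps h hγ hz, Multiset.sub_cons,
    ← Multiset.sub_singleton, tsub_right_comm, Multiset.sub_singleton, Multiset.cons_erase]
  rw [Multiset.mem_sub, Multiset.count_eq_zero_of_notMem]
  · exact Multiset.count_pos.2 (Multiset.mem_map.2 ⟨_, hmem, rfl⟩)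
  · intro hx
    obtain ⟨x, hx, heq⟩ := Multiset.mem_map.1 hx
    obtain ⟨hxd, hx⟩ := Finset.mem_erase.1 (Finset.mem_def.2 hx)
    have hx := ((mem_Icc_botL hγ hz).1 hx).2
    rcases lt_or_gt_of_ne hxd with hlt | hlt
    · exact (downL_strictMono hγ hlt hx hdownγ).ne heq
    · exact (downL_strictMono hγ hlt hdownγ hx).ne' heq

end Bounded

/-- lowering at `d = down_λ^a(z) ∈ [bot_λ]` when `γ = λ − ε_d ∈ P_ℓ^k`. -/
theorem statement7 (k ℓ : ℕ) (hℓ : 1 ≤ ℓ) (lam : ℕ → ℤ) (hlam : IsKBounded k ℓ lam)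
    (z : ℕ) (hz : z ∈ Finset.Icc 1 (botL k ℓ lam - 1)) (a : ℕ) (ha : 1 ≤ a)
    (hd : (downL k ℓ lam)^[a] z ∈ Finset.Icc 1 (botL k ℓ lam))
    (γ : ℕ → ℤ) (hγdef : γ = lam - eps ((downL k ℓ lam)^[a] z))
    (hγ : IsKBounded k ℓ γ) :
    katalan ℓ (DeltaK k ℓ lam) (Mz k ℓ lam z) (lam - eps ((downL k ℓ lam)^[a] z)) =
      wkschur k ℓ γ z -
        (if DownIterDefined ℓ (DeltaK k ℓ γ) (a + 1) z then
          katalan ℓ (DeltaK k ℓ γ) (Mz k ℓ γ z) (γ - eps ((downL k ℓ γ)^[a + 1] z))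
        else 0) +
      katalan ℓ (DeltaK k ℓ lam) (Mz k ℓ lam z) (lam - eps ((downL k ℓ lam)^[a + 1] z)) := by
  obtain ⟨hd1, hdb⟩ := Finset.mem_Icc.1 hd
  have hz1 := (Finset.mem_Icc.1 hz).1
  generalize hdef : (downL k ℓ lam)^[a] z = d at *
  subst hγdef
  have hdown : HasDown ℓ (DeltaK k ℓ lam) d := (le_botL_iff hlam hd1).1 hdb
  have hzd : z ≤ d := hdef ▸ ((iterate_downL hlam z (hdef ▸ hd1) 0 ha).2).le
  have hmem : (d, downL k ℓ lam d) ∈ DeltaK k ℓ lam := by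
    obtain ⟨j, hj⟩ := hdown
    rw [down_eq_of_isRemovable hlam hj]
    exact hj.1
  have hit : (downL k ℓ (lam - eps d))^[a] z = d :=
    (iterate_downL_sub_eps hlam hγ hdef.symm hd1 a le_rfl).trans hdef
  rw [katalan_erase DeltaK_subset hmem, sub_add_cancel, ← DeltaK_sub_eps hlam hdown,
    Function.iterate_succ_apply', Function.iterate_succ_apply', hdef, hit, wkschur]
  congr 1
  split_ifs with hiter
  · have hdownγ := (downIterDefined_sub_eps_iff hlam hγ hdef.symm hd1).1 hiter
    rw [Mz_eq_cons_of_hasDown hlam hγ hz1 hzd hdown hdownγ, katalan_cons]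
  · have hno := mt (downIterDefined_sub_eps_iff hlam hγ hdef.symm hd1).2 hiter
    rw [Mz_sub_eps_of_not_hasDown hlam hγ hz1 hzd hdown hno, sub_zero]

end
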